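/- The generalized Linnik characteristic function f(t) = (1 + λ|t|^α e^{-iθ sgn(t)})^{-ν}, with λ > 0, 0 < α ≤ 2, |θ| ≤ min(πα/2, π−πα/2), ν > 0, is self-decomposable: for every 0 < c < 1 there is a characteristic function f_c such that f(t) = f(ct) f_c(t) for all t ∈ ℝ. -/

import Mathlib

open MeasureTheory

/-- `f` is a characteristic function of a probability distribution on `ℝ`. -/
def IsCF (f : ℝ → ℂ) : Prop :=
  ∃ μ : Measure ℝ, IsProbabilityMeasure μ ∧
    ∀ t, f t = ∫ x, Complex.exp ((t:ℂ) * (x:ℂ) * Complex.I) ∂μ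

open Filter Topology

theorem isCF_iff_charFun {f : ℝ → ℂ} :
    IsCF f ↔ ∃ μ : Measure ℝ, IsProbabilityMeasure μ ∧ ∀ t, f t = charFun μ t := by
  simp only [IsCF, charFun_apply_real]

namespace IsCF

variable {f g : ℝ → ℂ}

theorem norm_le_one (hf : IsCF f) (t : ℝ) : ‖f t‖ ≤ 1 := by
  obtain ⟨μ, hμ, h⟩ := isCF_iff_charFun.1 hf
  exact h t ▸ norm_charFun_le_one t

theorem apply_zero (hf : IsCF f) : f 0 = 1 := by
  obtain ⟨μ, hμ, h⟩ := isCF_iff_charFun.1 hf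
  simp [h]

theorem expMulI (s : ℝ) : IsCF (fun t => Complex.exp ((t * s : ℝ) * Complex.I)) := by
  refine isCF_iff_charFun.2 ⟨Measure.dirac s, inferInstance, fun t => ?_⟩
  simp

theorem one : IsCF (fun _ => 1) := by simpa using expMulI 0

theorem mul (hf : IsCF f) (hg : IsCF g) : IsCF (fun t => f t * g t) := by
  obtain ⟨μ, hμ, hf⟩ := isCF_iff_charFun.1 hf
  obtain ⟨ν, hν, hg⟩ := isCF_iff_charFun.1 hg
  exact isCF_iff_charFun.2 ⟨μ.conv ν, inferInstance, fun t => by rw [charFun_conv, hf, hg]⟩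

theorem pow (hf : IsCF f) (n : ℕ) : IsCF (fun t => f t ^ n) := by
  induction n with
  | zero => simpa using one
  | succ n ih => simpa only [pow_succ] using ih.mul hf

theorem comp_mul (hf : IsCF f) (s : ℝ) : IsCF (fun t => f (s * t)) := by
  obtain ⟨μ, hμ, hf⟩ := isCF_iff_charFun.1 hf
  exact isCF_iff_charFun.2 ⟨μ.map (s * ·), Measure.isProbabilityMeasure_map (by fun_prop),
    fun t => by rw [charFun_map_mul, hf]⟩

/-- A countable mixture of characteristic functions is a characteristic function. -/
theorem hasSum {φ : ℕ → ℝ → ℂ} (hφ : ∀ k, IsCF (φ k)) {b : ℕ → ℝ} (hb : ∀ k, 0 ≤ b k)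
    (hb1 : HasSum b 1) (hf : ∀ t, HasSum (fun k => (b k : ℂ) * φ k t) (f t)) : IsCF f := by
  choose m hm hφ using fun k => isCF_iff_charFun.1 (hφ k)
  set P : Measure ℝ := Measure.sum (fun k => ENNReal.ofReal (b k) • m k) with hP
  have hPprob : IsProbabilityMeasure P := by
    constructor
    rw [hP, Measure.sum_apply _ MeasurableSet.univ]
    simp only [Measure.smul_apply, measure_univ, smul_eq_mul, mul_one]
    rw [← ENNReal.ofReal_tsum_of_nonneg hb hb1.summable, hb1.tsum_eq, ENNReal.ofReal_one]
  refine isCF_iff_charFun.2 ⟨P, hPprob, fun t => (hf t).unique ?_⟩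
  have hexp : Integrable (fun x : ℝ => Complex.exp (t * x * Complex.I)) P := by
    refine (integrable_const (1 : ℝ)).mono (by fun_prop) (ae_of_all _ fun x => ?_)
    rw [← Complex.ofReal_mul, Complex.norm_exp_ofReal_mul_I]
    simp
  rw [charFun_apply_real]
  have heq : (fun k => (b k : ℂ) * φ k t) =
      fun k => ∫ x, Complex.exp (t * x * Complex.I) ∂(ENNReal.ofReal (b k) • m k) := by
    ext k
    rw [integral_smul_measure, hφ, charFun_apply_real, ENNReal.toReal_ofReal (hb k),
      Complex.real_smul]
  exact heq ▸ hasSum_integral_measure hexp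

/-- A pointwise limit of characteristic functions which is continuous at `0` is a characteristic
function. -/
theorem of_tendsto {φ : ℕ → ℝ → ℂ} (hφ : ∀ n, IsCF (φ n)) (hf : ContinuousAt f 0)
    (h : ∀ t, Tendsto (fun n => φ n t) atTop (𝓝 (f t))) : IsCF f := by
  choose m hm hφ using fun k => isCF_iff_charFun.1 (hφ k)
  let M : ℕ → ProbabilityMeasure ℝ := fun n => ⟨m n, hm n⟩
  have hlim : ∀ t, Tendsto (fun n => charFun (M n : Measure ℝ) t) atTop (𝓝 (f t)) := fun t =>
    (h t).congr fun n => hφ n t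
  have htight : IsTightMeasureSet {((μ : ProbabilityMeasure ℝ) : Measure ℝ) | μ ∈ Set.range M} := by
    have := isTightMeasureSet_of_tendsto_charFun (μ := fun n => (M n : Measure ℝ)) hf hlim
    convert this using 1
    ext; simp
  obtain ⟨μ, -, hμ⟩ := (isCompact_closure_of_isTightMeasureSet htight).ultrafilter_le_nhds
    ((hyperfilter ℕ).map M) (.trans (by simp) (monotone_principal subset_closure))
  have hμ' : Tendsto M (hyperfilter ℕ) (𝓝 μ) := hμ
  refine isCF_iff_charFun.2 ⟨μ, inferInstance, fun t => ?_⟩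
  refine tendsto_nhds_unique ((hlim t).mono_left (Nat.hyperfilter_le_atTop)) ?_
  rw [ProbabilityMeasure.tendsto_iff_forall_integral_rclike_tendsto ℂ] at hμ'
  simp_rw [charFun_eq_integral_innerProbChar]
  exact hμ' _

/-- If `G` is continuous on the closed unit disc and given on the open disc by a power series with
nonnegative coefficients, and `G 1 = 1`, then `G ∘ h` is a characteristic function for every
characteristic function `h`. -/
theorem comp_powerSeries (hf : IsCF f) {G : ℂ → ℂ} {b : ℕ → ℝ} (hb : ∀ k, 0 ≤ b k)
    (hG : ∀ x : ℂ, ‖x‖ < 1 → HasSum (fun k => (b k : ℂ) * x ^ k) (G x))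
    (hcont : ContinuousOn G (Metric.closedBall 0 1)) (hG1 : G 1 = 1) :
    IsCF (fun t => G (f t)) := by
  have hrad : ∀ x : ℂ, ‖x‖ ≤ 1 →
      Tendsto (fun r : ℝ => G ((r : ℂ) * x)) (𝓝[<] 1) (𝓝 (G x)) := by
    intro x hx
    refine (hcont x (by simpa using hx)).tendsto.comp (tendsto_nhdsWithin_iff.2 ⟨?_, ?_⟩)
    · have : Continuous (fun r : ℝ => (r : ℂ) * x) := by fun_prop
      simpa using (this.tendsto 1).mono_left nhdsWithin_le_nhds
    · filter_upwards [Ioo_mem_nhdsLT (zero_lt_one' ℝ)] with r hr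
      simp only [Metric.mem_closedBall, dist_zero_right, norm_mul, Complex.norm_real,
        Real.norm_eq_abs, abs_of_pos hr.1]
      nlinarith [hr.1, hr.2, norm_nonneg x]
  have hpart : ∀ s : Finset ℕ, ∑ k ∈ s, b k ≤ 1 := by
    intro s
    have h1 : Tendsto (fun r : ℝ => ∑ k ∈ s, b k * r ^ k) (𝓝[<] 1) (𝓝 (∑ k ∈ s, b k)) := by
      have : Continuous (fun r : ℝ => ∑ k ∈ s, b k * r ^ k) := by fun_prop
      simpa using (this.tendsto 1).mono_left nhdsWithin_le_nhds
    have h2 : Tendsto (fun r : ℝ => (G ((r : ℂ) * 1)).re) (𝓝[<] 1) (𝓝 1) := by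
      simpa [hG1, Function.comp_def] using
        (Complex.continuous_re.tendsto _).comp (hrad 1 (by simp))
    refine le_of_tendsto_of_tendsto h1 h2 ?_
    filter_upwards [Ioo_mem_nhdsLT (zero_lt_one' ℝ)] with r hr
    have hs := Complex.hasSum_re (hG (r * 1) (by simpa [abs_of_pos hr.1] using hr.2))
    have hs' : HasSum (fun k => b k * r ^ k) (G ((r : ℂ) * 1)).re := by
      convert hs using 2 with k
      rw [mul_one, ← Complex.ofReal_pow, ← Complex.ofReal_mul, Complex.ofReal_re]
    exact sum_le_hasSum s (fun k _ => mul_nonneg (hb k) (pow_nonneg hr.1.le k)) hs'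
  have hsum : Summable b := summable_of_sum_le hb hpart
  have hclosed : ∀ x : ℂ, ‖x‖ ≤ 1 → HasSum (fun k => (b k : ℂ) * x ^ k) (G x) := by
    intro x hx
    have hbound : ∀ k, ‖(b k : ℂ) * x ^ k‖ ≤ b k := fun k => by
      simpa [abs_of_nonneg (hb k)] using mul_le_of_le_one_right (hb k) (pow_le_one₀ (norm_nonneg x) hx)
    have hsx : Summable (fun k => (b k : ℂ) * x ^ k) := .of_norm_bounded hsum hbound
    have ht : Tendsto (fun r : ℝ => ∑' k, (b k : ℂ) * ((r : ℂ) * x) ^ k) (𝓝[<] 1)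
        (𝓝 (∑' k, (b k : ℂ) * x ^ k)) := by
      refine tendsto_tsum_of_dominated_convergence hsum (fun k => ?_) ?_
      · have : Continuous (fun r : ℝ => (b k : ℂ) * ((r : ℂ) * x) ^ k) := by fun_prop
        simpa using (this.tendsto 1).mono_left nhdsWithin_le_nhds
      · filter_upwards [Ioo_mem_nhdsLT (zero_lt_one' ℝ)] with r hr k
        rw [mul_pow, mul_left_comm, norm_mul]
        refine (mul_le_of_le_one_left (norm_nonneg _) ?_).trans (hbound k)
        simpa [abs_of_pos hr.1] using pow_le_one₀ hr.1.le hr.2.le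
    have heq : ∑' k, (b k : ℂ) * x ^ k = G x := by
      refine tendsto_nhds_unique ht ((hrad x hx).congr' ?_)
      filter_upwards [Ioo_mem_nhdsLT (zero_lt_one' ℝ)] with r hr
      refine (hG _ ?_).tsum_eq.symm
      rw [norm_mul, Complex.norm_real, Real.norm_eq_abs, abs_of_pos hr.1]
      nlinarith [hr.1, hr.2, norm_nonneg x]
    exact heq ▸ hsx.hasSum
  refine hasSum (fun k => hf.pow k) hb ?_ fun t => hclosed _ (hf.norm_le_one t)
  have := Complex.hasSum_re (hclosed 1 (by simp))
  simpa [hG1] using this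

end IsCF

/-- The `k`-th Taylor coefficient at `0` of `x ↦ (1 - x) ^ a`. -/
noncomputable def oneSubRpowCoeff (a : ℝ) (k : ℕ) : ℝ := (-1) ^ k * Ring.choose a k

theorem oneSubRpowCoeff_zero (a : ℝ) : oneSubRpowCoeff a 0 = 1 := by simp [oneSubRpowCoeff]

theorem oneSubRpowCoeff_succ (a : ℝ) (k : ℕ) :
    oneSubRpowCoeff a (k + 1) = oneSubRpowCoeff a k * ((k - a) / (k + 1)) := by
  have hk : (k.factorial : ℝ) ≠ 0 := Nat.cast_ne_zero.2 k.factorial_ne_zero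
  have hk' : (k : ℝ) + 1 ≠ 0 := by positivity
  simp only [oneSubRpowCoeff, Ring.choose_eq_smul, descPochhammer_succ_right,
    Polynomial.smeval_mul, Polynomial.smeval_sub, Polynomial.smeval_X, Polynomial.smeval_natCast,
    Nat.factorial_succ, smul_eq_mul]
  push_cast
  field_simp
  simp
  ring

theorem oneSubRpowCoeff_one (a : ℝ) : oneSubRpowCoeff a 1 = -a := by
  simpa [oneSubRpowCoeff_zero] using oneSubRpowCoeff_succ a 0

theorem hasSum_one_sub_cpow (a : ℝ) {x : ℂ} (hx : ‖x‖ < 1) :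
    HasSum (fun k => (oneSubRpowCoeff a k : ℂ) * x ^ k) ((1 - x) ^ (a : ℂ)) := by
  have h := (Complex.one_add_cpow_hasFPowerSeriesOnBall_zero (a := (a : ℂ))).hasSum (y := -x)
    (by
      rw [← ENNReal.ofReal_one, Metric.eball_ofReal]
      simpa using hx)
  rw [zero_add, ← sub_eq_add_neg] at h
  refine HasSum.congr_fun h fun k => ?_
  simp only [binomialSeries_apply, List.ofFn_const, List.prod_replicate, smul_eq_mul,
    oneSubRpowCoeff, ← Complex.ofReal_choose]
  rw [neg_pow]
  push_cast
  ring

theorem oneSubRpowCoeff_nonneg_of_le {a : ℝ} {m : ℕ} (ham : a ≤ m)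
    (hm : 0 ≤ oneSubRpowCoeff a m) {k : ℕ} (hk : m ≤ k) : 0 ≤ oneSubRpowCoeff a k := by
  induction k, hk using Nat.le_induction with
  | base => exact hm
  | succ k hk ih =>
    rw [oneSubRpowCoeff_succ]
    have : (m : ℝ) ≤ k := by exact_mod_cast hk
    exact mul_nonneg ih (div_nonneg (by linarith) (by positivity))

theorem oneSubRpowCoeff_nonpos_of_le {a : ℝ} {m : ℕ} (ham : a ≤ m)
    (hm : oneSubRpowCoeff a m ≤ 0) {k : ℕ} (hk : m ≤ k) : oneSubRpowCoeff a k ≤ 0 := by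
  induction k, hk using Nat.le_induction with
  | base => exact hm
  | succ k hk ih =>
    rw [oneSubRpowCoeff_succ]
    have : (m : ℝ) ≤ k := by exact_mod_cast hk
    exact mul_nonpos_of_nonpos_of_nonneg ih (div_nonneg (by linarith) (by positivity))

theorem mem_slitPlane_one_sub {x : ℂ} (hx : ‖x‖ ≤ 1) (hx1 : x ≠ 1) :
    1 - x ∈ Complex.slitPlane := by
  have hre : x.re ≤ 1 := (Complex.re_le_norm x).trans hx
  rcases hre.lt_or_eq with h | h
  · exact Or.inl (by simpa using h)
  · refine absurd (Complex.ext h ?_) hx1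
    have := Complex.sq_norm x
    rw [Complex.normSq_apply, h] at this
    have h1 : ‖x‖ ^ 2 ≤ 1 := pow_le_one₀ (norm_nonneg x) hx
    have : x.im * x.im ≤ 0 := by linarith
    simpa using le_antisymm this (mul_self_nonneg _)

theorem continuousOn_one_sub_cpow {a : ℝ} (ha : 0 < a) :
    ContinuousOn (fun x : ℂ => (1 - x) ^ (a : ℂ)) (Metric.closedBall 0 1) := by
  intro x hx
  refine ContinuousAt.continuousWithinAt ?_
  have hsub : ContinuousAt (fun x : ℂ => 1 - x) x := by fun_prop
  rcases eq_or_ne x 1 with rfl | hx1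
  · have := Complex.continuousAt_cpow_zero_of_re_pos (z := (a : ℂ)) (by simpa using ha)
    exact ContinuousAt.comp (f := fun x : ℂ => ((1 - x, (a : ℂ)) : ℂ × ℂ))
      (g := fun p : ℂ × ℂ => p.1 ^ p.2) (by simpa using this) (by fun_prop)
  · exact hsub.cpow continuousAt_const (mem_slitPlane_one_sub (by simpa using hx) hx1)

namespace IsCF

variable {f : ℝ → ℂ}

/-- The Sibuya transform. -/
theorem one_sub_one_sub_cpow (hf : IsCF f) {β : ℝ} (hβ : 0 < β) (hβ1 : β ≤ 1) :
    IsCF (fun t => 1 - (1 - f t) ^ (β : ℂ)) := by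
  refine hf.comp_powerSeries (G := fun x => 1 - (1 - x) ^ (β : ℂ))
    (b := fun k => if k = 0 then 0 else -oneSubRpowCoeff β k) (fun k => ?_) (fun x hx => ?_)
    (continuousOn_const.sub (continuousOn_one_sub_cpow hβ)) (by simp [hβ.ne'])
  · split_ifs with hk
    · rfl
    · exact neg_nonneg.2 (oneSubRpowCoeff_nonpos_of_le (m := 1) (by simpa using hβ1)
        (by rw [oneSubRpowCoeff_one]; linarith) (Nat.one_le_iff_ne_zero.2 hk))
  · refine ((hasSum_ite_eq 0 (1 : ℂ)).sub (hasSum_one_sub_cpow β hx)).congr_fun fun k => ?_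
    split_ifs with hk
    · simp [hk, oneSubRpowCoeff_zero]
    · simp

/-- The compound of a characteristic function by the offspring law of the stable branching
process. -/
theorem add_one_sub_cpow_div (hf : IsCF f) {α : ℝ} (hα : 1 ≤ α) (hα2 : α ≤ 2) :
    IsCF (fun t => f t + (1 - f t) ^ (α : ℂ) / α) := by
  have hα0 : 0 < α := by linarith
  have hαc : (α : ℂ) ≠ 0 := by exact_mod_cast hα0.ne'
  refine hf.comp_powerSeries (G := fun x => x + (1 - x) ^ (α : ℂ) / α)
    (b := fun k => if k = 1 then 0 else oneSubRpowCoeff α k / α) (fun k => ?_) (fun x hx => ?_)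
    (continuousOn_id.add ((continuousOn_one_sub_cpow hα0).div_const _)) (by simp [hα0.ne'])
  · split_ifs with hk
    · rfl
    · refine div_nonneg ?_ hα0.le
      rcases k with _ | _ | k
      · simp [oneSubRpowCoeff_zero]
      · exact absurd rfl hk
      · refine oneSubRpowCoeff_nonneg_of_le (m := 2) (by simpa using hα2) ?_ (by omega)
        rw [oneSubRpowCoeff_succ α 1, oneSubRpowCoeff_one]
        push_cast
        nlinarith
  · refine ((hasSum_ite_eq 1 x).add
      ((hasSum_one_sub_cpow α hx).div_const (α : ℂ))).congr_fun fun k => ?_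
    split_ifs with hk
    · simp only [hk, oneSubRpowCoeff_one]
      push_cast
      field_simp
      simp
    · push_cast
      ring

/-- Negative binomial compounds of characteristic functions. -/
theorem negBinomial (hf : IsCF f) {a ν : ℝ} (ha : 0 < a) (ha1 : a ≤ 1) (hν : 0 < ν) :
    IsCF (fun t => (a : ℂ) ^ (ν : ℂ) * (1 - (1 - a) * f t) ^ (-(ν : ℂ))) := by
  have hnorm : ∀ x : ℂ, ‖x‖ ≤ 1 → ‖(1 - (a : ℂ)) * x‖ < 1 := by
    intro x hx
    rw [norm_mul, ← Complex.ofReal_one, ← Complex.ofReal_sub, Complex.norm_real, Real.norm_eq_abs,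
      abs_of_nonneg (by linarith)]
    nlinarith [norm_nonneg x]
  refine hf.comp_powerSeries (G := fun x => (a : ℂ) ^ (ν : ℂ) * (1 - (1 - a) * x) ^ (-(ν : ℂ)))
    (b := fun k => a ^ ν * (oneSubRpowCoeff (-ν) k * (1 - a) ^ k)) (fun k => ?_) (fun x hx => ?_)
    ?_ ?_
  · exact mul_nonneg (Real.rpow_nonneg ha.le _) (mul_nonneg
      (oneSubRpowCoeff_nonneg_of_le (m := 0) (by simpa using hν.le)
        (by simp [oneSubRpowCoeff_zero]) k.zero_le) (pow_nonneg (by linarith) k))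
  · have h := (hasSum_one_sub_cpow (-ν) (hnorm x hx.le)).mul_left ((a : ℂ) ^ (ν : ℂ))
    rw [Complex.ofReal_neg] at h
    refine HasSum.congr_fun h fun k => ?_
    rw [mul_pow]
    push_cast [Complex.ofReal_cpow ha.le]
    ring
  · intro x hx
    refine (ContinuousAt.mul continuousAt_const ?_).continuousWithinAt
    have hsub : ContinuousAt (fun x : ℂ => 1 - (1 - (a : ℂ)) * x) x := by fun_prop
    have hn := hnorm x (by simpa using hx)
    exact hsub.cpow continuousAt_const (mem_slitPlane_one_sub hn.le (fun h => by simp [h] at hn))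
  · have : (a : ℂ) ≠ 0 := by exact_mod_cast ha.ne'
    simp only [mul_one, sub_sub_cancel]
    rw [← Complex.cpow_add _ _ this]
    simp

/-- Geometric compounds of characteristic functions. -/
theorem inv_one_add_mul_one_sub (hf : IsCF f) {K : ℝ} (hK : 0 ≤ K) :
    IsCF (fun t => (1 + K * (1 - f t))⁻¹) := by
  have hK1 : 0 < 1 + K := by linarith
  have hKc : (1 + K : ℂ) ≠ 0 := by exact_mod_cast hK1.ne'
  convert hf.negBinomial (a := (1 + K)⁻¹) (ν := 1) (by positivity)
    (inv_le_one_of_one_le₀ (by linarith)) one_pos using 2 with t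
  rw [Complex.ofReal_one, Complex.cpow_one, Complex.cpow_neg_one, Complex.ofReal_inv, ← mul_inv]
  push_cast
  congr 1
  field_simp
  ring

end IsCF

/-- The exponent `|t| ^ α * e ^ (-iθ sgn t)` of a strictly stable law. -/
noncomputable def stableExponent (α θ t : ℝ) : ℂ :=
  ((|t| ^ α : ℝ) : ℂ) * Complex.exp (-((θ * Real.sign t : ℝ) : ℂ) * Complex.I)

theorem stableExponent_zero {α : ℝ} (hα : α ≠ 0) (θ : ℝ) : stableExponent α θ 0 = 0 := by
  simp [stableExponent, Real.zero_rpow hα]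

theorem stableExponent_neg (α θ t : ℝ) : stableExponent α θ (-t) = stableExponent α (-θ) t := by
  rw [stableExponent, stableExponent, abs_neg, Real.sign_neg, mul_neg, neg_mul θ]

theorem stableExponent_mul (α θ : ℝ) {c : ℝ} (hc : 0 < c) (t : ℝ) :
    stableExponent α θ (c * t) = (c ^ α : ℝ) * stableExponent α θ t := by
  have hs : Real.sign (c * t) = Real.sign t := by
    rcases lt_trichotomy t 0 with h | rfl | h
    · rw [Real.sign_of_neg h, Real.sign_of_neg (mul_neg_of_pos_of_neg hc h)]
    · simp
    · rw [Real.sign_of_pos h, Real.sign_of_pos (mul_pos hc h)]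
  rw [stableExponent, stableExponent, hs, abs_mul, abs_of_pos hc,
    Real.mul_rpow hc.le (abs_nonneg t)]
  push_cast
  ring

theorem abs_mul_sign_le (θ t : ℝ) : |θ * Real.sign t| ≤ |θ| := by
  rcases Real.sign_apply_eq t with h | h | h <;> simp [h]

theorem stableExponent_re_nonneg (α : ℝ) {θ : ℝ} (hθ : |θ| ≤ Real.pi / 2) (t : ℝ) :
    0 ≤ (stableExponent α θ t).re := by
  have h := abs_le.1 ((abs_mul_sign_le θ t).trans hθ)
  rw [stableExponent, Complex.re_ofReal_mul, ← Complex.ofReal_neg, Complex.exp_ofReal_mul_I_re,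
    Real.cos_neg]
  exact mul_nonneg (Real.rpow_nonneg (abs_nonneg t) _) (Real.cos_nonneg_of_neg_pi_div_two_le_of_le
    (by linarith) h.2)

theorem continuousAt_stableExponent_zero {α : ℝ} (hα : 0 < α) (θ : ℝ) :
    ContinuousAt (stableExponent α θ) 0 := by
  rw [ContinuousAt, stableExponent_zero hα.ne', tendsto_zero_iff_norm_tendsto_zero]
  have : Continuous (fun t : ℝ => |t| ^ α) := continuous_abs.rpow_const fun _ => Or.inr hα.le
  have h0 := this.tendsto 0
  rw [abs_zero, Real.zero_rpow hα.ne'] at h0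
  refine h0.congr fun t => ?_
  rw [stableExponent, norm_mul, ← Complex.ofReal_neg, Complex.norm_exp_ofReal_mul_I, mul_one,
    Complex.norm_real, Real.norm_eq_abs, abs_of_nonneg (Real.rpow_nonneg (abs_nonneg t) _)]

theorem ofReal_mul_exp_mul_I_cpow {r φ : ℝ} (hr : 0 < r) (h1 : -Real.pi < φ) (h2 : φ ≤ Real.pi)
    (a : ℝ) : ((r : ℂ) * Complex.exp (φ * Complex.I)) ^ (a : ℂ) =
      ((r ^ a : ℝ) : ℂ) * Complex.exp ((a * φ : ℝ) * Complex.I) := by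
  have hr0 : (r : ℂ) ≠ 0 := by exact_mod_cast hr.ne'
  rw [Complex.cpow_def_of_ne_zero (mul_ne_zero hr0 (Complex.exp_ne_zero _)),
    Complex.log_ofReal_mul hr (Complex.exp_ne_zero _),
    Complex.log_exp (by simpa using h1) (by simpa using h2), add_mul, Complex.exp_add,
    Real.rpow_def_of_pos hr]
  push_cast
  ring_nf

theorem stableExponent_cpow {α θ β : ℝ} (hα : 0 < α) (hβ : 0 < β) (hθ : |θ| < Real.pi) (t : ℝ) :
    stableExponent α θ t ^ (β : ℂ) = stableExponent (α * β) (θ * β) t := by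
  rcases eq_or_ne t 0 with rfl | ht
  · rw [stableExponent_zero hα.ne', stableExponent_zero (mul_pos hα hβ).ne',
      Complex.zero_cpow (by exact_mod_cast hβ.ne')]
  · have h := abs_lt.1 ((abs_mul_sign_le θ t).trans_lt hθ)
    rw [stableExponent, ← Complex.ofReal_neg, ofReal_mul_exp_mul_I_cpow
      (Real.rpow_pos_of_pos (abs_pos.2 ht) _) (by linarith) (by linarith),
      ← Real.rpow_mul (abs_nonneg t), stableExponent]
    congr 3
    push_cast
    ring

theorem stableExponent_mem_slitPlane {α θ t : ℝ} (hθ : |θ| < Real.pi) (ht : t ≠ 0) :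
    stableExponent α θ t ∈ Complex.slitPlane := by
  have h := abs_lt.1 ((abs_mul_sign_le θ t).trans_lt hθ)
  have hr := Real.rpow_pos_of_pos (abs_pos.2 ht) α
  rw [Complex.mem_slitPlane_iff_arg]
  refine ⟨?_, ?_⟩
  · rw [stableExponent, ← Complex.ofReal_neg, Complex.arg_real_mul _ hr, Complex.arg_exp_mul_I,
      (toIocMod_eq_self _).2 ⟨by linarith, by linarith⟩]
    linarith
  · exact mul_ne_zero (by exact_mod_cast hr.ne') (Complex.exp_ne_zero _)

theorem neg_mul_I_cpow {α : ℝ} (hα : 0 < α) (t : ℝ) :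
    -((t : ℂ) * Complex.I) ^ (α : ℂ) =
      stableExponent α (Real.pi - Real.pi * α / 2) t := by
  rcases eq_or_ne t 0 with rfl | ht
  · rw [stableExponent_zero hα.ne', Complex.ofReal_zero, zero_mul,
      Complex.zero_cpow (by exact_mod_cast hα.ne'), neg_zero]
  · have key : (t : ℂ) * Complex.I =
        (|t| : ℝ) * Complex.exp ((Real.pi / 2 * Real.sign t : ℝ) * Complex.I) := by
      rcases ht.lt_or_gt with h | h
      · rw [Real.sign_of_neg h, abs_of_neg h]
        simp [Complex.exp_neg, Complex.exp_pi_div_two_mul_I]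
      · rw [Real.sign_of_pos h, abs_of_pos h]
        simp [Complex.exp_pi_div_two_mul_I]
    have hb := abs_le.1 (abs_mul_sign_le (Real.pi / 2) t)
    rw [abs_of_pos (by positivity)] at hb
    rw [key, ofReal_mul_exp_mul_I_cpow (abs_pos.2 ht) (by linarith [Real.pi_pos])
      (by linarith [Real.pi_pos]), stableExponent, ← mul_neg]
    congr 1
    have hpi : Complex.exp (-((Real.pi * Real.sign t : ℝ) : ℂ) * Complex.I) = -1 := by
      rcases ht.lt_or_gt with h | h
      · rw [Real.sign_of_neg h]
        simp
      · rw [Real.sign_of_pos h]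
        simp [Complex.exp_neg]
    rw [← mul_neg_one, ← hpi, ← Complex.exp_add]
    congr 1
    push_cast
    ring

theorem tendsto_natCast_add_one_mul_one_sub_exp (t : ℝ) :
    Tendsto (fun n : ℕ => ((n : ℂ) + 1) * (1 - Complex.exp (-(t / (n + 1) : ℝ) * Complex.I)))
      atTop (𝓝 (t * Complex.I)) := by
  have hd : HasDerivAt (fun s : ℝ => -Complex.exp (-(s * t : ℝ) * Complex.I)) (t * Complex.I) 0 := by
    have h1 : HasDerivAt (fun s : ℝ => -((s * t : ℝ) : ℂ) * Complex.I) (-(t : ℂ) * Complex.I) 0 := by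
      have := ((hasDerivAt_id (0 : ℝ)).mul_const t).ofReal_comp
      simpa using (this.neg.mul_const Complex.I)
    simpa using h1.cexp.fun_neg
  have hlim := hd.tendsto_slope_zero_right.comp
    (tendsto_nhdsWithin_iff.2 ⟨tendsto_one_div_add_atTop_nhds_zero_nat (𝕜 := ℝ),
      Eventually.of_forall fun n => by simp only [Set.mem_Ioi]; positivity⟩)
  refine hlim.congr fun n => ?_
  simp
  ring_nf

theorem ofReal_mul_cpow {r : ℝ} (hr : 0 < r) (w : ℂ) (a : ℝ) :
    ((r : ℂ) * w) ^ (a : ℂ) = ((r ^ a : ℝ) : ℂ) * w ^ (a : ℂ) := by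
  have hr0 : (r : ℂ) ≠ 0 := by exact_mod_cast hr.ne'
  rcases eq_or_ne w 0 with rfl | hw
  · rcases eq_or_ne a 0 with rfl | ha
    · simp
    · simp [ha]
  · rw [Complex.cpow_def_of_ne_zero (mul_ne_zero hr0 hw), Complex.log_ofReal_mul hr hw, add_mul,
      Complex.exp_add, Real.rpow_def_of_pos hr, Complex.cpow_def_of_ne_zero hw]
    push_cast
    rfl

theorem mul_inv_cpow_of_re_pos {A B : ℂ} (hA : 0 < A.re) (hB : 0 < B.re) (a : ℂ) :
    (A * B⁻¹) ^ a = A ^ a * (B ^ a)⁻¹ := by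
  have hA0 : A ≠ 0 := fun h => by simp [h] at hA
  have hB0 : B ≠ 0 := fun h => by simp [h] at hB
  have hargA := abs_lt.1 (Complex.abs_arg_lt_pi_div_two_iff.2 (Or.inl hA))
  have hargB := abs_lt.1 (Complex.abs_arg_lt_pi_div_two_iff.2 (Or.inl hB))
  have hBpi : B.arg ≠ Real.pi :=
    (hargB.2.trans (by linarith [Real.pi_pos])).ne
  rw [← Complex.inv_cpow _ _ hBpi, Complex.cpow_def_of_ne_zero (mul_ne_zero hA0 (inv_ne_zero hB0)),
    Complex.log_mul hA0 (inv_ne_zero hB0), add_mul, Complex.exp_add,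
    Complex.cpow_def_of_ne_zero hA0, Complex.cpow_def_of_ne_zero (inv_ne_zero hB0)]
  rw [Complex.arg_inv, if_neg hBpi]
  constructor <;> linarith

theorem IsCF.one_add_exp_mul_cpow {α : ℝ} (hα : 1 ≤ α) (hα2 : α ≤ 2) :
    IsCF (fun t => 1 + Complex.exp (t * Complex.I) *
      (1 - Complex.exp (-t * Complex.I)) ^ (α : ℂ) / α) := by
  convert (IsCF.expMulI 1).mul ((IsCF.expMulI (-1)).add_one_sub_cpow_div hα hα2) using 2 with t
  rw [mul_one, mul_neg_one, Complex.ofReal_neg, mul_add, ← Complex.exp_add, ← add_mul,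
    add_neg_cancel, zero_mul, Complex.exp_zero, mul_div_assoc]

/-- The spectrally one-sided stable exponents are limits of compound Poisson exponents. -/
theorem IsCF.exists_tendsto_stableExponent {α : ℝ} (hα : 1 ≤ α) (hα2 : α ≤ 2) :
    ∃ h : ℕ → ℝ → ℂ, (∀ n, IsCF (h n)) ∧ ∃ M : ℕ → ℝ, (∀ n, 0 < M n) ∧
      ∀ t, Tendsto (fun n => (M n : ℂ) * (1 - h n t)) atTop
        (𝓝 (stableExponent α (Real.pi - Real.pi * α / 2) t)) := by
  have hα0 : 0 < α := by linarith
  have hαc : (α : ℂ) ≠ 0 := by exact_mod_cast hα0.ne'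
  refine ⟨fun n t => _, fun n => (one_add_exp_mul_cpow hα hα2).comp_mul (1 / ((n : ℝ) + 1)),
    fun n => α * ((n : ℝ) + 1) ^ α, fun n => by positivity, fun t => ?_⟩
  rw [← neg_mul_I_cpow hα0]
  have h1 : Tendsto (fun n : ℕ => Complex.exp ((1 / ((n : ℝ) + 1) * t : ℝ) * Complex.I)) atTop
      (𝓝 1) := by
    have hc : Continuous fun s : ℝ => Complex.exp ((s * t : ℝ) * Complex.I) := by fun_prop
    simpa [Function.comp_def] using (hc.tendsto 0).comp (tendsto_one_div_add_atTop_nhds_zero_nat (𝕜 := ℝ))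
  have h2 : Tendsto (fun n : ℕ => (((n : ℂ) + 1) *
      (1 - Complex.exp (-(t / (n + 1) : ℝ) * Complex.I))) ^ (α : ℂ)) atTop
      (𝓝 (((t : ℂ) * Complex.I) ^ (α : ℂ))) := by
    rcases eq_or_ne t 0 with rfl | ht
    · simp
    · exact (tendsto_natCast_add_one_mul_one_sub_exp t).cpow tendsto_const_nhds
        (Or.inr (by simpa using ht))
  rw [← one_mul (((t : ℂ) * Complex.I) ^ (α : ℂ))]
  refine (h1.mul h2).neg.congr fun n => ?_
  have hn : (0 : ℝ) < (n : ℝ) + 1 := by positivity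
  rw [show (n : ℂ) + 1 = ((n + 1 : ℝ) : ℂ) by push_cast; rfl, ofReal_mul_cpow hn,
    show t / ((n : ℝ) + 1) = 1 / ((n : ℝ) + 1) * t by ring]
  push_cast
  field_simp
  ring

theorem IsCF.inv_one_add_stableExponent_of_nonneg {α θ l : ℝ} (hα : 0 < α) (hθ0 : 0 ≤ θ)
    (hθ : θ ≤ Real.pi * α / 2) (hθ' : θ ≤ Real.pi - Real.pi * α / 2) (hl : 0 ≤ l) :
    IsCF (fun t => (1 + l * stableExponent α θ t)⁻¹) := by
  have hpi := Real.pi_pos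
  have hpa : 0 < Real.pi * α := by positivity
  have hθhalf : |θ| ≤ Real.pi / 2 := by rw [abs_of_nonneg hθ0]; linarith
  set β := (θ + Real.pi * α / 2) / Real.pi with hβdef
  have hβπ : β * Real.pi = θ + Real.pi * α / 2 := div_mul_cancel₀ _ hpi.ne'
  have hβ : 0 < β := by positivity
  have hβ1 : β ≤ 1 := by rw [hβdef, div_le_one hpi]; linarith
  have hβα : β ≤ α := by rw [hβdef, div_le_iff₀ hpi]; linarith
  have hαβ : α / β ≤ 2 := by
    rw [div_le_iff₀ hβ, ← mul_le_mul_iff_left₀ hpi, mul_assoc, hβπ]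
    linarith
  have hαβ1 : 1 ≤ α / β := (one_le_div hβ).2 hβα
  obtain ⟨h, hh, M, hM, hlim⟩ := IsCF.exists_tendsto_stableExponent hαβ1 hαβ
  set θ₀ := Real.pi - Real.pi * (α / β) / 2 with hθ₀
  have hθ₀π : |θ₀| < Real.pi := by
    rw [abs_lt]
    constructor <;> nlinarith
  have hθ₀β : θ₀ * β = θ := by
    have : α / β * β = α := div_mul_cancel₀ _ hβ.ne'
    linear_combination hβπ - Real.pi / 2 * this
  have hpow : ∀ t, Tendsto (fun n => ((M n : ℂ) * (1 - h n t)) ^ (β : ℂ)) atTop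
      (𝓝 (stableExponent α θ t)) := by
    intro t
    have hval : stableExponent α θ t = stableExponent (α / β) θ₀ t ^ (β : ℂ) := by
      rw [stableExponent_cpow (by positivity) hβ hθ₀π, hθ₀β, div_mul_cancel₀ _ hβ.ne']
    rw [hval]
    rcases eq_or_ne t 0 with rfl | ht
    · have h0 : ∀ n, h n 0 = 1 := fun n => (hh n).apply_zero
      simp [h0, stableExponent_zero (show α / β ≠ 0 by positivity)]
    · exact (hlim t).cpow tendsto_const_nhds (stableExponent_mem_slitPlane hθ₀π ht)
  have hne : ∀ t, 1 + l * stableExponent α θ t ≠ 0 := fun t ht => by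
    have h1 := congrArg Complex.re ht
    rw [Complex.add_re, Complex.re_ofReal_mul, Complex.one_re, Complex.zero_re] at h1
    nlinarith [stableExponent_re_nonneg α hθhalf t]
  refine IsCF.of_tendsto (fun n => ((hh n).one_sub_one_sub_cpow hβ hβ1).inv_one_add_mul_one_sub
    (K := l * M n ^ β) (mul_nonneg hl (Real.rpow_nonneg (hM n).le _))) ?_ fun t => ?_
  · exact (continuousAt_const.add (continuousAt_const.mul
      (continuousAt_stableExponent_zero hα θ))).inv₀ (hne 0)
  · refine ((tendsto_const_nhds.add (tendsto_const_nhds.mul (hpow t))).inv₀ (hne t)).congr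
      fun n => ?_
    rw [ofReal_mul_cpow (hM n)]
    push_cast
    ring_nf

theorem IsCF.inv_one_add_stableExponent {α θ l : ℝ} (hα : 0 < α)
    (hθ : |θ| ≤ min (Real.pi * α / 2) (Real.pi - Real.pi * α / 2)) (hl : 0 ≤ l) :
    IsCF (fun t => (1 + l * stableExponent α θ t)⁻¹) := by
  obtain ⟨h1, h2⟩ := le_min_iff.1 hθ
  rcases le_total 0 θ with h | h
  · rw [abs_of_nonneg h] at h1 h2
    exact inv_one_add_stableExponent_of_nonneg hα h h1 h2 hl
  · rw [abs_of_nonpos h] at h1 h2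
    simpa [stableExponent_neg] using
      (inv_one_add_stableExponent_of_nonneg hα (neg_nonneg.2 h) h1 h2 hl).comp_mul (-1)

/-- The generalized Linnik characteristic function
`f(t) = (1 + λ|t|^α e^{-iθ sgn t})^{-ν}` is self-decomposable (class L). -/
theorem generalized_Linnik_selfdecomposable
    (l α θ ν : ℝ) (hl : 0 < l) (hα : 0 < α ∧ α ≤ 2) (hν : 0 < ν)
    (hθ : |θ| ≤ min (Real.pi * α / 2) (Real.pi - Real.pi * α / 2))
    (f : ℝ → ℂ)
    (hf : ∀ t : ℝ, f t = (1 + ((l * |t| ^ α : ℝ) : ℂ) *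
      Complex.exp (-(((θ * Real.sign t : ℝ)) : ℂ) * Complex.I)) ^ (-(ν:ℂ))) :
    ∀ c : ℝ, 0 < c → c < 1 → ∃ fc : ℝ → ℂ, IsCF fc ∧
      ∀ t : ℝ, f t = f (c * t) * fc t := by
  intro c hc hc1
  have hf' : ∀ t, f t = (1 + l * stableExponent α θ t) ^ (-(ν : ℂ)) := fun t => by
    rw [hf, stableExponent, Complex.ofReal_mul, mul_assoc]
  have hθhalf : |θ| ≤ Real.pi / 2 := by
    obtain ⟨h1, h2⟩ := le_min_iff.1 hθ
    linarith
  have ha : 0 < c ^ α := Real.rpow_pos_of_pos hc α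
  have ha1 : c ^ α ≤ 1 := Real.rpow_le_one hc.le hc1.le hα.1.le
  have hac : ((c ^ α : ℝ) : ℂ) ≠ 0 := by exact_mod_cast ha.ne'
  refine ⟨_, (IsCF.inv_one_add_stableExponent hα.1 hθ
    (mul_nonneg hl.le ha.le)).negBinomial ha ha1 hν, fun t => ?_⟩
  have hre := stableExponent_re_nonneg α hθhalf t
  rw [hf', hf', stableExponent_mul α θ hc]
  set ψ := stableExponent α θ t
  have hA : 0 < (1 + l * ψ).re := by
    rw [Complex.add_re, Complex.re_ofReal_mul, Complex.one_re]
    positivity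
  have hB : 0 < (1 + (l * c ^ α : ℝ) * ψ).re := by
    rw [Complex.add_re, Complex.re_ofReal_mul, Complex.one_re]
    positivity
  have hBeq : 1 + l * ((c ^ α : ℝ) * ψ) = 1 + (l * c ^ α : ℝ) * ψ := by
    push_cast
    ring
  rw [hBeq]
  have hBdef : 1 + (l * c ^ α : ℝ) * ψ - 1 = (c ^ α : ℝ) * (l * ψ) := by
    push_cast
    ring
  generalize 1 + (l * c ^ α : ℝ) * ψ = B at hB hBdef ⊢
  have hB0 : B ≠ 0 := by
    rintro rfl
    simp at hB
  have hmix : 1 - (1 - ((c ^ α : ℝ) : ℂ)) * B⁻¹ = (c ^ α : ℝ) * ((1 + l * ψ) * B⁻¹) := by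
    field_simp
    linear_combination hBdef
  rw [hmix, ← Complex.ofReal_neg, ofReal_mul_cpow ha, mul_inv_cpow_of_re_pos hA hB,
    Real.rpow_neg ha.le, Complex.ofReal_inv, Complex.ofReal_cpow ha.le]
  have h1 : ((c ^ α : ℝ) : ℂ) ^ (ν : ℂ) ≠ 0 := by simp [Complex.cpow_eq_zero_iff, hac]
  have h2 : B ^ ((-ν : ℝ) : ℂ) ≠ 0 := by simp [Complex.cpow_eq_zero_iff, hB0]
  field_simp
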